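/- arXiv:2004.02737 — 3 statements merged into one kernel-verified Lean document; each statement's English description precedes it below -/
import Mathlib

section
/- Let K = ℚ(q, z₁, z₂, z₃) be the field of rational functions in four variables over ℚ, and let V = K^n. Then the trigonometric R-matrix satisfies the Yang–Baxter equation with spectral parameter: R₁₂(z₁/z₂) · R₁₃(z₁/z₃) · R₂₃(z₂/z₃) = R₂₃(z₂/z₃) · R₁₃(z₁/z₃) · R₁₂(z₁/z₂), as an equality in End(V ⊗ V ⊗ V), where for X ∈ End(V ⊗ V) the operators X₁₂, X₁₃, X₂₃ act as X in the indicated pair of tensor factors of V ⊗ V ⊗ V and as the identity in the remaining factor. -/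
/-!
STATEMENT 0: The trigonometric R-matrix of type Â satisfies the Yang–Baxter
equation with spectral parameter, as an equality in End(V ⊗ V ⊗ V), where
V = K^n and K = ℚ(q, z₁, z₂, z₃).
-/

open MvPolynomial

noncomputable section

/-- The field ℚ(q, z₁, z₂, z₃). -/
abbrev K0 : Type := FractionRing (MvPolynomial (Fin 4) ℚ)

noncomputable def q0 : K0 := algebraMap (MvPolynomial (Fin 4) ℚ) K0 (X 0)
noncomputable def z1 : K0 := algebraMap (MvPolynomial (Fin 4) ℚ) K0 (X 1)
noncomputable def z2 : K0 := algebraMap (MvPolynomial (Fin 4) ℚ) K0 (X 2)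
noncomputable def z3 : K0 := algebraMap (MvPolynomial (Fin 4) ℚ) K0 (X 3)

/-- The trigonometric R-matrix
`R(x) = Σ_{i,j} E_ii⊗E_jj ((q−xq⁻¹)/(1−x))^{δ_ij}
        + (q−q⁻¹) Σ_{i≠j} E_ij⊗E_ji x^{δ_{i<j}}/(1−x)`,
written as a matrix on the index set `Fin n × Fin n` (basis of V ⊗ V). -/
def Rmat (n : ℕ) {K : Type*} [Field K] (q x : K) :
    Matrix (Fin n × Fin n) (Fin n × Fin n) K :=
  Matrix.of fun p r =>
    (if p = r then (if p.1 = p.2 then (q - x * q⁻¹) / (1 - x) else 1) else 0) +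
    (if p.1 ≠ p.2 ∧ r.1 = p.2 ∧ r.2 = p.1 then
      (q - q⁻¹) * (if p.1 < p.2 then x else 1) / (1 - x) else 0)

/-- An operator `X` on V⊗V acting in tensor factors 1 and 2 of V⊗V⊗V. -/
def pl12 (n : ℕ) {K : Type*} [Field K]
    (Xm : Matrix (Fin n × Fin n) (Fin n × Fin n) K) :
    Matrix (Fin n × Fin n × Fin n) (Fin n × Fin n × Fin n) K :=
  Matrix.of fun p r => Xm (p.1, p.2.1) (r.1, r.2.1) * (if p.2.2 = r.2.2 then 1 else 0)

/-- An operator `X` on V⊗V acting in tensor factors 1 and 3 of V⊗V⊗V. -/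
def pl13 (n : ℕ) {K : Type*} [Field K]
    (Xm : Matrix (Fin n × Fin n) (Fin n × Fin n) K) :
    Matrix (Fin n × Fin n × Fin n) (Fin n × Fin n × Fin n) K :=
  Matrix.of fun p r => Xm (p.1, p.2.2) (r.1, r.2.2) * (if p.2.1 = r.2.1 then 1 else 0)

/-- An operator `X` on V⊗V acting in tensor factors 2 and 3 of V⊗V⊗V. -/
def pl23 (n : ℕ) {K : Type*} [Field K]
    (Xm : Matrix (Fin n × Fin n) (Fin n × Fin n) K) :
    Matrix (Fin n × Fin n × Fin n) (Fin n × Fin n × Fin n) K :=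
  Matrix.of fun p r => Xm (p.2.1, p.2.2) (r.2.1, r.2.2) * (if p.1 = r.1 then 1 else 0)

/-- The coefficient of `E_ii ⊗ E_jj` in `R(x)`. -/
def diagCoeff {n : ℕ} {K : Type*} [Field K] (q x : K) (i j : Fin n) : K :=
  if i = j then (q - x * q⁻¹) / (1 - x) else 1

/-- The coefficient of `E_ij ⊗ E_ji` in `R(x)`. -/
def swapCoeff {n : ℕ} {K : Type*} [Field K] (q x : K) (i j : Fin n) : K :=
  if i = j then 0 else (q - q⁻¹) * (if i < j then x else 1) / (1 - x)

theorem Rmat_apply {n : ℕ} {K : Type*} [Field K] (q x : K) (i j k l : Fin n) :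
    Rmat n q x (i, j) (k, l) =
      (if k = i then if l = j then diagCoeff q x i j else 0 else 0) +
        (if k = j then if l = i then swapCoeff q x i j else 0 else 0) := by
  simp only [Rmat, Matrix.of_apply, diagCoeff, swapCoeff, Prod.mk.injEq]
  congr 1 <;> grind

theorem pl12_Rmat_mul_apply {n : ℕ} {K : Type*} [Field K] (q x : K)
    (M : Matrix (Fin n × Fin n × Fin n) (Fin n × Fin n × Fin n) K) (i j k : Fin n)
    (r : Fin n × Fin n × Fin n) :
    (pl12 n (Rmat n q x) * M) (i, j, k) r =
      diagCoeff q x i j * M (i, j, k) r + swapCoeff q x i j * M (j, i, k) r := by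
  simp [Matrix.mul_apply, pl12, Rmat_apply, Fintype.sum_prod_type, add_mul, ite_mul,
    Finset.sum_add_distrib]

theorem pl13_Rmat_mul_apply {n : ℕ} {K : Type*} [Field K] (q x : K)
    (M : Matrix (Fin n × Fin n × Fin n) (Fin n × Fin n × Fin n) K) (i j k : Fin n)
    (r : Fin n × Fin n × Fin n) :
    (pl13 n (Rmat n q x) * M) (i, j, k) r =
      diagCoeff q x i k * M (i, j, k) r + swapCoeff q x i k * M (k, j, i) r := by
  simp [Matrix.mul_apply, pl13, Rmat_apply, Fintype.sum_prod_type, add_mul, ite_mul,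
    Finset.sum_add_distrib]

theorem pl23_Rmat_mul_apply {n : ℕ} {K : Type*} [Field K] (q x : K)
    (M : Matrix (Fin n × Fin n × Fin n) (Fin n × Fin n × Fin n) K) (i j k : Fin n)
    (r : Fin n × Fin n × Fin n) :
    (pl23 n (Rmat n q x) * M) (i, j, k) r =
      diagCoeff q x j k * M (i, j, k) r + swapCoeff q x j k * M (i, k, j) r := by
  simp [Matrix.mul_apply, pl23, Rmat_apply, Fintype.sum_prod_type, add_mul, ite_mul,
    Finset.sum_add_distrib]

/-- The Yang–Baxter equation over any field, at spectral parameters where `R` has no pole. -/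
theorem yang_baxter_of_ne (n : ℕ) {K : Type*} [Field K] {q u v w : K} (hq : q ≠ 0)
    (hv : v ≠ 0) (hw : w ≠ 0) (huv : u ≠ v) (huw : u ≠ w) (hvw : v ≠ w) :
    pl12 n (Rmat n q (u / v)) * pl13 n (Rmat n q (u / w)) * pl23 n (Rmat n q (v / w))
      = pl23 n (Rmat n q (v / w)) * pl13 n (Rmat n q (u / w)) * pl12 n (Rmat n q (u / v)) := by
  have hvu' : v - u ≠ 0 := sub_ne_zero.2 huv.symm
  have hwu' : w - u ≠ 0 := sub_ne_zero.2 huw.symm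
  have hwv' : w - v ≠ 0 := sub_ne_zero.2 hvw.symm
  have one_sub_uv : 1 - u / v = (v - u) / v := by field_simp
  have one_sub_uw : 1 - u / w = (w - u) / w := by field_simp
  have one_sub_vw : 1 - v / w = (w - v) / w := by field_simp
  suffices h : pl12 n (Rmat n q (u / v)) * (pl13 n (Rmat n q (u / w)) *
      (pl23 n (Rmat n q (v / w)) * 1)) = pl23 n (Rmat n q (v / w)) *
        (pl13 n (Rmat n q (u / w)) * (pl12 n (Rmat n q (u / v)) * 1)) by
    simpa only [Matrix.mul_one, Matrix.mul_assoc] using h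
  ext ⟨i, j, k⟩ r
  simp only [pl12_Rmat_mul_apply, pl13_Rmat_mul_apply, pl23_Rmat_mul_apply]
  generalize (1 : Matrix (Fin n × Fin n × Fin n) (Fin n × Fin n × Fin n) K) = M
  simp only [diagCoeff, swapCoeff, one_sub_uv, one_sub_uw, one_sub_vw]
  rcases lt_trichotomy i j with hij | hij | hij <;>
  rcases lt_trichotomy j k with hjk | hjk | hjk <;>
  rcases lt_trichotomy i k with hik | hik | hik <;>
  first
  | (exfalso; order)
  | (subst_vars
     simp only [*, ne_of_lt, ne_of_gt, not_lt_of_gt, lt_irrefl, if_true, if_false]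
     field_simp
     all_goals ring)

/-- The Yang–Baxter equation
`R₁₂(z₁/z₂) R₁₃(z₁/z₃) R₂₃(z₂/z₃) = R₂₃(z₂/z₃) R₁₃(z₁/z₃) R₁₂(z₁/z₂)`. -/
theorem yang_baxter (n : ℕ) (hn : 1 ≤ n) :
    pl12 n (Rmat n q0 (z1 / z2)) * pl13 n (Rmat n q0 (z1 / z3)) *
        pl23 n (Rmat n q0 (z2 / z3))
      = pl23 n (Rmat n q0 (z2 / z3)) * pl13 n (Rmat n q0 (z1 / z3)) *
          pl12 n (Rmat n q0 (z1 / z2)) := by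
  have inj := IsFractionRing.injective (MvPolynomial (Fin 4) ℚ) K0
  have ne_zero (i : Fin 4) : algebraMap (MvPolynomial (Fin 4) ℚ) K0 (X i) ≠ 0 :=
    (map_ne_zero_iff _ inj).2 (X_ne_zero i)
  have ne {i j : Fin 4} (h : i ≠ j) : algebraMap (MvPolynomial (Fin 4) ℚ) K0 (X i) ≠
      algebraMap (MvPolynomial (Fin 4) ℚ) K0 (X j) :=
    inj.ne ((X_injective).ne h)
  exact yang_baxter_of_ne n (ne_zero 0) (ne_zero 2) (ne_zero 3) (ne (by decide))
    (ne (by decide)) (ne (by decide))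

end
end

section
/- Let K = ℚ(q, z) and V = K^n. Then R₁₂(z) · R₂₁(1/z) = f(z) · Id_{V⊗V}, where R₂₁(w) = P·R(w)·P with P the permutation operator, and f(z) = (1 − z q²)(1 − z q⁻²)/(1 − z)². -/
/-!
STATEMENT 1: Unitarity of the trigonometric R-matrix:
`R₁₂(z) · R₂₁(1/z) = f(z) · Id`, where `R₂₁(w) = P · R(w) · P` and
`f(z) = (1 − z q²)(1 − z q⁻²)/(1 − z)²`, over K = ℚ(q, z), V = K^n.
-/

open MvPolynomial

noncomputable section

/-- The field ℚ(q, z). -/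
abbrev K1 : Type := FractionRing (MvPolynomial (Fin 2) ℚ)

noncomputable def q1 : K1 := algebraMap (MvPolynomial (Fin 2) ℚ) K1 (X 0)
noncomputable def zz : K1 := algebraMap (MvPolynomial (Fin 2) ℚ) K1 (X 1)

/-- The permutation operator `P = Σ_{i,j} E_ij ⊗ E_ji` on V ⊗ V. -/
def Pmat (n : ℕ) (K : Type*) [Field K] :
    Matrix (Fin n × Fin n) (Fin n × Fin n) K :=
  Matrix.of fun p r => if r.1 = p.2 ∧ r.2 = p.1 then 1 else 0

/-- Left multiplication by the R-matrix mixes only the rows `p` and `p.swap`. -/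
theorem Rmat_mul_apply {K : Type*} [Field K] (n : ℕ) (q x : K)
    (M : Matrix (Fin n × Fin n) (Fin n × Fin n) K) (p r : Fin n × Fin n) :
    (Rmat n q x * M) p r =
      (if p.1 = p.2 then (q - x * q⁻¹) / (1 - x) else 1) * M p r +
      (if p.1 = p.2 then 0 else (q - q⁻¹) * (if p.1 < p.2 then x else 1) / (1 - x)) *
        M p.swap r := by
  have hswap : ∀ s : Fin n × Fin n, (s.1 = p.2 ∧ s.2 = p.1) ↔ s = p.swap := fun s => by
    simp [Prod.ext_iff]
  by_cases h : p.1 = p.2 <;>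
    simp [Matrix.mul_apply, Rmat, add_mul, Finset.sum_add_distrib, hswap, h]

theorem Pmat_mul_mul_Pmat {K : Type*} [Field K] (n : ℕ)
    (M : Matrix (Fin n × Fin n) (Fin n × Fin n) K) :
    Pmat n K * M * Pmat n K = M.submatrix Prod.swap Prod.swap := by
  have hswap : ∀ p s : Fin n × Fin n, (s.1 = p.2 ∧ s.2 = p.1) ↔ s = p.swap := fun p s => by
    simp [Prod.ext_iff]
  have hswap' : ∀ p s : Fin n × Fin n, s = p.swap ↔ p = s.swap := fun p s => by
    constructor <;> rintro rfl <;> simp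
  ext p r
  have hright : ∀ s, (if r = s.swap then (1 : K) else 0) = if s = r.swap then 1 else 0 :=
    fun s => by simp only [hswap' s r]
  simp [Matrix.mul_apply, Pmat, hswap, hright]

/-- Unitarity of the R-matrix over any field, away from the poles. -/
theorem Rmat_mul_Rmat_inv {K : Type*} [Field K] (n : ℕ) {q z : K}
    (hq : q ≠ 0) (hz : z ≠ 0) (hz1 : z ≠ 1) :
    Rmat n q z * (Pmat n K * Rmat n q z⁻¹ * Pmat n K)
      = ((1 - z * q ^ 2) * (1 - z * (q ^ 2)⁻¹) / (1 - z) ^ 2) •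
          (1 : Matrix (Fin n × Fin n) (Fin n × Fin n) K) := by
  have h1 : 1 - z ≠ 0 := sub_ne_zero.mpr hz1.symm
  have h3 : 1 - z⁻¹ = (z - 1) / z := by field_simp
  have h4 : z - 1 = -(1 - z) := by ring
  rw [Pmat_mul_mul_Pmat]
  ext ⟨i, j⟩ ⟨k, l⟩
  rw [Rmat_mul_apply]
  simp only [Matrix.submatrix_apply, Rmat, Matrix.of_apply, Matrix.smul_apply, Matrix.one_apply,
    Prod.swap_prod_mk, Prod.mk.injEq, smul_eq_mul, h3, h4]
  rcases lt_trichotomy i j with hij | rfl | hij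
  · by_cases hd : i = k ∧ j = l
    · obtain ⟨rfl, rfl⟩ := hd
      simp [hij.ne, hij.ne', hij]
      field_simp
      ring
    · by_cases ho : j = k ∧ i = l
      · obtain ⟨rfl, rfl⟩ := ho
        simp [hij.ne, hij.ne', hij.not_gt, hij]
        field_simp
        ring
      · have hd' : ¬(j = l ∧ i = k) := fun h => hd h.symm
        have ho₁ : ¬(i = l ∧ j = k) := fun h => ho h.symm
        have ho₂ : ¬(l = i ∧ k = j) := fun h => ho ⟨h.2.symm, h.1.symm⟩
        have hd₂ : ¬(l = j ∧ k = i) := fun h => hd ⟨h.2.symm, h.1.symm⟩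
        simp [hd, hd', ho₁, ho₂, hd₂]
  · by_cases hd : i = k ∧ i = l
    · obtain ⟨rfl, rfl⟩ := hd
      simp
      field_simp
      ring
    · have hd' : ¬(i = l ∧ i = k) := fun h => hd h.symm
      simp [hd, hd']
  · by_cases hd : i = k ∧ j = l
    · obtain ⟨rfl, rfl⟩ := hd
      simp [hij.ne, hij.ne', hij.not_gt]
      field_simp
      ring
    · by_cases ho : j = k ∧ i = l
      · obtain ⟨rfl, rfl⟩ := ho
        simp [hij.ne, hij.ne', hij.not_gt, hij]
        field_simp
        ring
      · have hd' : ¬(j = l ∧ i = k) := fun h => hd h.symm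
        have ho₁ : ¬(i = l ∧ j = k) := fun h => ho h.symm
        have ho₂ : ¬(l = i ∧ k = j) := fun h => ho ⟨h.2.symm, h.1.symm⟩
        have hd₂ : ¬(l = j ∧ k = i) := fun h => hd ⟨h.2.symm, h.1.symm⟩
        simp [hd, hd', ho₁, ho₂, hd₂]

theorem q1_ne_zero : q1 ≠ 0 := by
  simp [q1]

theorem zz_ne_zero : zz ≠ 0 := by
  simp [zz]

theorem zz_ne_one : zz ≠ 1 := by
  intro h
  have hX : (X 1 : MvPolynomial (Fin 2) ℚ) = 1 :=
    IsFractionRing.injective _ K1 (by rw [map_one]; exact h)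
  simpa using congrArg (eval 0) hX

/-- Unitarity: `R₁₂(z) R₂₁(1/z) = f(z) Id` with
`f(z) = (1−zq²)(1−zq⁻²)/(1−z)²`. -/
theorem unitarity (n : ℕ) (hn : 1 ≤ n) :
    Rmat n q1 zz * (Pmat n K1 * Rmat n q1 zz⁻¹ * Pmat n K1)
      = ((1 - zz * q1 ^ 2) * (1 - zz * (q1 ^ 2)⁻¹) / (1 - zz) ^ 2) •
          (1 : Matrix (Fin n × Fin n) (Fin n × Fin n) K1) := by
  exact Rmat_mul_Rmat_inv n q1_ne_zero zz_ne_zero zz_ne_one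

end
end

section
/- Let t ≥ 1, let c₀ > c₁ > ⋯ > c_t be integers, and let k₁, …, k_t be positive integers; set k = k₁ + ⋯ + k_t and j = c₀. Define α = Σ_{s=1}^{t} [ (k_s(c_{s−1} − c_s) − k_s − (c_{s−1} − c_s) + gcd(c_{s−1} − c_s, k_s))/2 + k_s(c₀ − c_{s−1}) ]. Then Σ_{s=1}^{t} Σ_{a=c_s}^{c_{s−1}−1} a · ( ⌊(a − c_s + 1)·k_s/(c_{s−1} − c_s)⌋ − ⌊(a − c_s)·k_s/(c_{s−1} − c_s)⌋ ) = k·j − k − α. -/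
/-!
STATEMENT 11: Let t ≥ 1, let c₀ > c₁ > ⋯ > c_t be integers and k₁, …, k_t
positive integers; set k = k₁ + ⋯ + k_t and j = c₀, and let
α = Σ_{s=1}^{t} [ (k_s(c_{s−1}−c_s) − k_s − (c_{s−1}−c_s)
                   + gcd(c_{s−1}−c_s, k_s))/2 + k_s(c₀−c_{s−1}) ].
Then Σ_{s=1}^{t} Σ_{a=c_s}^{c_{s−1}−1}
  a·(⌊(a−c_s+1)·k_s/(c_{s−1}−c_s)⌋ − ⌊(a−c_s)·k_s/(c_{s−1}−c_s)⌋) = k·j − k − α.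
(All divisions below are integer divisions; since the relevant numerators are
nonnegative — resp. nonnegative and even — they compute the floors, resp. the
exact halves, appearing in the statement.)
-/

/-- Two integers that add up to a multiple `n * k` have floors mod `n` adding up to `k` or `k - 1`,
according to whether `n` divides them. -/
theorem Int.ediv_add_ediv_sub {n : ℤ} (hn : 0 < n) (k x : ℤ) :
    x / n + (n * k - x) / n = k - 1 + if n ∣ x then 1 else 0 := by
  have h : (n * k - x) / n = k + (-x) / n := by
    rw [show n * k - x = -x + n * k by ring, Int.add_mul_ediv_left _ _ hn.ne']
    ring
  rw [h]
  split_ifs with hd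
  · obtain ⟨y, rfl⟩ := hd
    rw [Int.mul_ediv_cancel_left _ hn.ne', ← mul_neg, Int.mul_ediv_cancel_left _ hn.ne']
    ring
  · have h0 : 0 < x % n :=
      lt_of_le_of_ne (Int.emod_nonneg x hn.ne') fun h => hd (Int.dvd_of_emod_eq_zero h.symm)
    have h1 : (-x) / n = -(x / n) - 1 := by
      rw [Int.ediv_eq_iff_of_pos hn]
      have h2 := Int.mul_ediv_add_emod x n
      have h3 := Int.emod_lt_of_pos x hn
      constructor <;> nlinarith
    rw [h1]
    ring

theorem Nat.card_filter_dvd_succ_mul {n : ℕ} (hn : 0 < n) (k : ℕ) :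
    ((Finset.range n).filter fun i => n ∣ (i + 1) * k).card = Nat.gcd n k := by
  have hg : 0 < Nat.gcd n k := Nat.gcd_pos_of_pos_left k hn
  have h : ∀ i : ℕ, n ∣ (i + 1) * k ↔ n / Nat.gcd n k ∣ i + 1 := fun i => by
    rw [← (Nat.coprime_div_gcd_div_gcd hg).dvd_mul_right,
      Nat.div_dvd_iff_dvd_mul (Nat.gcd_dvd_left n k) hg, mul_left_comm,
      Nat.mul_div_cancel' (Nat.gcd_dvd_right n k)]
  simp only [h]
  rw [Nat.card_multiples, Nat.div_div_self (Nat.gcd_dvd_left n k) hn.ne']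

theorem two_mul_sum_range_mul_ediv {n : ℕ} (hn : 0 < n) (k : ℕ) :
    2 * ∑ i ∈ Finset.range n, ((i : ℤ) * k / n) = k * n - k - n + Nat.gcd n k := by
  have hn' : (0 : ℤ) < n := by exact_mod_cast hn
  have hpair : ∀ i ∈ Finset.range n, ((i + 1 : ℕ) : ℤ) * k / n + ((n - 1 - i : ℕ) : ℤ) * k / n
      = (k - 1) + if n ∣ (i + 1) * k then 1 else 0 := fun i hi => by
    have hi' := Finset.mem_range.mp hi
    have h := Int.ediv_add_ediv_sub hn' k (((i + 1 : ℕ) : ℤ) * k)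
    rw [← sub_mul, show (n : ℤ) - (i + 1 : ℕ) = (n - 1 - i : ℕ) by omega] at h
    rw [h]
    simp only [← Nat.cast_mul, Int.natCast_dvd_natCast]
  have hsum := Finset.sum_congr rfl hpair
  rw [Finset.sum_add_distrib, Finset.sum_add_distrib,
    Finset.sum_range_reflect (fun i : ℕ => (i : ℤ) * k / n), Finset.sum_boole,
    Nat.card_filter_dvd_succ_mul hn, Finset.sum_const, Finset.card_range, nsmul_eq_mul] at hsum
  have hshift := (Finset.sum_range_succ (fun i : ℕ => (i : ℤ) * k / n) n).symm.trans
    (Finset.sum_range_succ' (fun i : ℕ => (i : ℤ) * k / n) n)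
  rw [Int.mul_ediv_cancel_left _ hn'.ne'] at hshift
  simp only [Nat.cast_zero, zero_mul, Int.zero_ediv, add_zero] at hshift
  linarith

theorem sum_range_add_mul_sub (F : ℕ → ℤ) (b : ℤ) (n : ℕ) :
    ∑ i ∈ Finset.range n, (b + i) * (F (i + 1) - F i)
      = (b + n - 1) * F n - (b - 1) * F 0 - ∑ i ∈ Finset.range n, F i := by
  induction n with
  | zero => simp
  | succ n ih =>
    rw [Finset.sum_range_succ, Finset.sum_range_succ, ih]
    push_cast
    ring

theorem sum_Icc_mul_ediv_sub_ediv {b d k : ℤ} (hbd : b < d) (hk : 0 < k) :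
    ∑ a ∈ Finset.Icc b (d - 1), a * ((a - b + 1) * k / (d - b) - (a - b) * k / (d - b))
      = k * d - k - (k * (d - b) - k - (d - b) + (Int.gcd (d - b) k : ℤ)) / 2 := by
  obtain ⟨n, hn⟩ := Int.eq_ofNat_of_zero_le (sub_pos.mpr hbd).le
  obtain ⟨m, rfl⟩ := Int.eq_ofNat_of_zero_le hk.le
  obtain rfl : d = b + n := by omega
  have hn0 : 0 < n := by omega
  have hreindex : ∀ f : ℤ → ℤ,
      ∑ a ∈ Finset.Icc b (b + n - 1), f a = ∑ i ∈ Finset.range n, f (b + i) := fun f => by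
    refine (Finset.sum_bij (fun (i : ℕ) _ => b + (i : ℤ)) ?_ ?_ ?_ ?_).symm
    · intro i hi
      simp only [Finset.mem_range, Finset.mem_Icc] at hi ⊢
      omega
    · intro i _ j _ h
      simpa using h
    · intro a ha
      simp only [Finset.mem_Icc] at ha
      exact ⟨(a - b).toNat, by simp only [Finset.mem_range]; omega, by omega⟩
    · intro i _
      rfl
  have habel := sum_range_add_mul_sub (fun i => (i : ℤ) * m / n) b n
  have hn0' : (n : ℤ) ≠ 0 := by exact_mod_cast hn0.ne'
  simp only [Int.mul_ediv_cancel_left _ hn0', Nat.cast_zero, zero_mul, Int.zero_ediv, mul_zero,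
    Nat.cast_add, Nat.cast_one] at habel
  rw [hreindex]
  simp only [add_sub_cancel_left, Int.gcd_natCast_natCast]
  rw [habel, ← two_mul_sum_range_mul_ediv hn0, Int.mul_ediv_cancel_left _ two_ne_zero]
  ring

theorem alpha_combinatorial_identity (t : ℕ) (ht : 1 ≤ t)
    (c : ℕ → ℤ) (k : ℕ → ℤ)
    (hc : ∀ s, s < t → c (s + 1) < c s)
    (hk : ∀ s, 1 ≤ s → s ≤ t → 0 < k s) :
    (∑ s ∈ Finset.Icc 1 t, ∑ a ∈ Finset.Icc (c s) (c (s - 1) - 1),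
        a * ((a - c s + 1) * k s / (c (s - 1) - c s)
              - (a - c s) * k s / (c (s - 1) - c s)))
      = (∑ s ∈ Finset.Icc 1 t, k s) * c 0 - (∑ s ∈ Finset.Icc 1 t, k s)
        - ∑ s ∈ Finset.Icc 1 t,
            ((k s * (c (s - 1) - c s) - k s - (c (s - 1) - c s)
                + (Int.gcd (c (s - 1) - c s) (k s) : ℤ)) / 2
              + k s * (c 0 - c (s - 1))) := by
  rw [Finset.sum_mul, ← Finset.sum_sub_distrib, ← Finset.sum_sub_distrib]
  refine Finset.sum_congr rfl fun s hs => ?_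
  obtain ⟨hs1, hst⟩ := Finset.mem_Icc.mp hs
  have hlt : c s < c (s - 1) := by
    simpa [Nat.sub_add_cancel hs1] using hc (s - 1) (by omega)
  rw [sum_Icc_mul_ediv_sub_ediv hlt (hk s hs1 hst)]
  ring
end
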